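/- Let k be a field of characteristic 0, 𝒞 a curved differential Γ-graded category over k, and z a central element of degree 2 of 𝒞 (a collection z_X ∈ End(X)² with α∘z_X = z_Y∘α and α∘d(z_X) = (−1)^{|α|} d(z_Y)∘α for all α: X → Y). Then φ ∘ b₀^{z} = v·λ_{d(z)} ∘ φ as maps H̄och^{II}(𝒞)[[v]] → (𝒞/[𝒞,𝒞])[[v]], where b₀^{z}(a₀[a₁|⋯|aₙ]) = Σ_{j=0}^{n}(−1)^{|a₀|+⋯+|a_j|−j} a₀[a₁|⋯|a_j|z_{X_{j+1}}|a_{j+1}|⋯|aₙ] and λ_{d(z)} is the (well-defined) endomorphism of 𝒞/[𝒞,𝒞] induced by left multiplication by the elements d(z_X). -/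

import Mathlib

noncomputable section

open Finset

/-- The grading group `Γ` (to be thought of as `ℤ` or `ℤ/2ℤ`): an additive
commutative group with one, together with its parity homomorphism to `ℤ/2ℤ`
(through which all Koszul signs are computed). -/
class GradingGroup (Γ : Type) extends AddCommGroupWithOne Γ where
  parity : Γ →+ ZMod 2
  parity_one : parity 1 = 1

/-- The Koszul sign `(−1)^{|γ|}` in `k`. -/
def gsign (k : Type) [Field k] {Γ : Type} [GradingGroup Γ] (γ : Γ) : k :=
  (-1 : k) ^ (GradingGroup.parity γ).val

/-- The Koszul sign `(−1)^{|γ|·|γ'|}` in `k`. -/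
def gsign2 (k : Type) [Field k] {Γ : Type} [GradingGroup Γ] (γ γ' : Γ) : k :=
  (-1 : k) ^ (GradingGroup.parity γ * GradingGroup.parity γ').val

/-- `degSum g j = g 0 + ⋯ + g (j-1)` : the sum of the first `j` degrees. -/
def degSum {Γ : Type} [GradingGroup Γ] (g : ℕ → Γ) (j : ℕ) : Γ :=
  ∑ t ∈ Finset.range j, g t

/-- Read a sequence cyclically with period `m + 1`. -/
def cyc {α : Type} (m : ℕ) (X : ℕ → α) : ℕ → α := fun i => X (i % (m + 1))

/-- Contract a chain at position `j`, multiplying the `j`-th and `(j+1)`-st entries. -/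
def contractChain {E : Type} [Mul E] (a : ℕ → E) (j : ℕ) : ℕ → E :=
  fun i => if i < j then a i else if i = j then a j * a (j + 1) else a (i + 1)

/-- Omit the `(j+1)`-st term of a sequence of objects. -/
def dropIdx {α : Type} (X : ℕ → α) (j : ℕ) : ℕ → α :=
  fun i => if i ≤ j then X i else X (i + 1)

/-- Insert `x` into a chain after position `j`. -/
def insertChain {E : Type} (a : ℕ → E) (j : ℕ) (x : E) : ℕ → E :=
  fun i => if i ≤ j then a i else if i = j + 1 then x else a (i - 1)

/-- Insert `x` into a chain so that it occupies position `j`. -/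
def insertAt {E : Type} (a : ℕ → E) (j : ℕ) (x : E) : ℕ → E :=
  fun i => if i < j then a i else if i = j then x else a (i - 1)

/-- Duplicate the `(j+1)`-st term of a sequence of objects. -/
def dupIdx {α : Type} (X : ℕ → α) (j : ℕ) : ℕ → α :=
  fun i => if i ≤ j + 1 then X i else X (i - 1)

/-- The ordered product `f 0 * f 1 * ⋯ * f m`. -/
def chainProd {E : Type} [Mul E] (f : ℕ → E) : ℕ → E
  | 0 => f 0
  | m + 1 => chainProd f m * f (m + 1)

/-- Extend a `Fin (n+1)`-tuple of naturals by zero. -/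
def extTuple {n : ℕ} (v : Fin (n + 1) → ℕ) : ℕ → ℕ :=
  fun t => if h : t < n + 1 then v ⟨t, h⟩ else 0

/-- A curved differential `Γ`-graded category over `k`, presented through its
"category algebra": `E` is an ambient unital `k`-algebra containing all the
morphism spaces `Hom X Y` (composition being the multiplication of `E`),
`deg γ` is the subspace of homogeneous elements of degree `γ`, `diff` is the
family of degree-one differentials `δ`, and `curv X ∈ Hom X X` are the degree-two
curvature elements, satisfying `δ(h_X) = 0` and `δ²(f) = h_Y f − f h_X`. -/
structure CdgCategory (k : Type) [Field k] (Γ : Type) [GradingGroup Γ] where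
  Obj : Type
  E : Type
  [ringE : Ring E]
  [algE : Algebra k E]
  Hom : Obj → Obj → Submodule k E
  deg : Γ → Submodule k E
  idm : Obj → E
  diff : E →ₗ[k] E
  curv : Obj → E
  idm_mem : ∀ X, idm X ∈ Hom X X
  idm_deg : ∀ X, idm X ∈ deg 0
  mul_hom_mem : ∀ {X Y Z : Obj} {f g : E}, f ∈ Hom Y Z → g ∈ Hom X Y → f * g ∈ Hom X Z
  mul_deg_mem : ∀ {γ γ' : Γ} {f g : E}, f ∈ deg γ → g ∈ deg γ' → f * g ∈ deg (γ + γ')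
  idm_comp : ∀ {X Y : Obj} {g : E}, g ∈ Hom X Y → idm Y * g = g
  comp_idm : ∀ {X Y : Obj} {g : E}, g ∈ Hom X Y → g * idm X = g
  diff_hom : ∀ {X Y : Obj} {f : E}, f ∈ Hom X Y → diff f ∈ Hom X Y
  diff_deg : ∀ {γ : Γ} {f : E}, f ∈ deg γ → diff f ∈ deg (γ + 1)
  diff_leibniz : ∀ {γ : Γ} {f : E}, f ∈ deg γ → ∀ g : E,
      diff (f * g) = diff f * g + gsign k γ • (f * diff g)
  curv_mem : ∀ X, curv X ∈ Hom X X
  curv_deg : ∀ X, curv X ∈ deg (2 : Γ)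
  diff_sq : ∀ {X Y : Obj} {f : E}, f ∈ Hom X Y → diff (diff f) = curv Y * f - f * curv X
  diff_curv : ∀ X, diff (curv X) = 0

attribute [instance] CdgCategory.ringE CdgCategory.algE

variable {k Γ : Type} [Field k] [GradingGroup Γ]

/-- `a 0, …, a n` is a cyclically composable chain of morphisms for the objects
`X 0, …, X n` (with `X (n+1) = X 0`), i.e. `aᵢ : X_{i+1} → X_i`. -/
def CdgCategory.Composable (C : CdgCategory k Γ) (n : ℕ)
    (X : ℕ → C.Obj) (a : ℕ → C.E) : Prop :=
  ∀ i ≤ n, a i ∈ C.Hom (cyc n X (i + 1)) (X i)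

/-- Each `a i` (for `i ≤ n`) is homogeneous of degree `g i`. -/
def CdgCategory.Homog (C : CdgCategory k Γ) (n : ℕ) (g : ℕ → Γ) (a : ℕ → C.E) : Prop :=
  ∀ i ≤ n, a i ∈ C.deg (g i)

/-- A model of the weight components of the reduced Hochschild complex of the second
kind `H̄och^{II}(C)` of a cdg category `C` : `W n` models the weight-`n` component,
`gen n X a` models the chain `a₀[ā₁|⋯|āₙ]` (for cyclically composable morphisms
`aᵢ : X_{i+1} → X_i`, `X_{n+1} = X₀`), and `H̄och^{II}(C) = ∏ₙ Wₙ`. -/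
structure RedHochCore (k Γ : Type) [Field k] [GradingGroup Γ] (C : CdgCategory k Γ) where
  W : ℕ → Type
  [addW : ∀ n, AddCommGroup (W n)]
  [modW : ∀ n, Module k (W n)]
  gen : (n : ℕ) → (ℕ → C.Obj) → (ℕ → C.E) → W n
  gen_ext : ∀ {n : ℕ} {X X' : ℕ → C.Obj} {a a' : ℕ → C.E},
      (∀ i ≤ n, X i = X' i) → (∀ i ≤ n, a i = a' i) → gen n X a = gen n X' a'
  gen_add : ∀ (n : ℕ) (X : ℕ → C.Obj) (a : ℕ → C.E) (i : ℕ), i ≤ n → ∀ x y : C.E,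
      gen n X (Function.update a i (x + y)) =
        gen n X (Function.update a i x) + gen n X (Function.update a i y)
  gen_smul : ∀ (n : ℕ) (X : ℕ → C.Obj) (a : ℕ → C.E) (i : ℕ), i ≤ n → ∀ (c : k) (x : C.E),
      gen n X (Function.update a i (c • x)) = c • gen n X (Function.update a i x)
  span_gen : ∀ n : ℕ, Submodule.span k
      {w : W n | ∃ X a g, C.Composable n X a ∧ C.Homog n g a ∧ w = gen n X a} = ⊤
  gen_reduced : ∀ (n : ℕ) (X : ℕ → C.Obj) (a : ℕ → C.E) (i : ℕ),
      1 ≤ i → i ≤ n → a i = C.idm (X i) → gen n X a = 0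

attribute [instance] RedHochCore.addW RedHochCore.modW

variable {C : CdgCategory k Γ}

/-- The statement that `b₂` (the bar part of the Hochschild differential, including
the cyclic term) satisfies its defining formula on homogeneous composable chains. -/
def IsB2 (H : RedHochCore k Γ C) (b2 : (n : ℕ) → H.W (n + 1) →ₗ[k] H.W n) : Prop :=
  ∀ (n : ℕ) (X : ℕ → C.Obj) (a : ℕ → C.E) (g : ℕ → Γ),
    C.Composable (n + 1) X a → C.Homog (n + 1) g a →
    b2 n (H.gen (n + 1) X a) =
      (∑ j ∈ Finset.range (n + 1), gsign k (degSum g (j + 1) - (j : Γ)) •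
          H.gen n (dropIdx X j) (contractChain a j))
      - gsign2 k (g (n + 1) - 1) (degSum g (n + 1) - (n : Γ)) •
          H.gen n (fun i => if i = 0 then X (n + 1) else X i)
                (fun i => if i = 0 then a (n + 1) * a 0 else a i)

/-- The statement that `B` is the Connes cyclic operator of the reduced complex,
`B(a₀[ā₁|⋯|āₙ]) = ∑ₗ ± 1[ā_l|⋯|āₙ|ā₀|⋯|ā_{l−1}]`, with its Koszul signs. -/
def IsConnesB (H : RedHochCore k Γ C) (B : (n : ℕ) → H.W n →ₗ[k] H.W (n + 1)) : Prop :=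
  ∀ (n : ℕ) (X : ℕ → C.Obj) (a : ℕ → C.E) (g : ℕ → Γ),
    C.Composable n X a → C.Homog n g a →
    B n (H.gen n X a) = ∑ l ∈ Finset.range (n + 1),
      gsign2 k ((∑ t ∈ Finset.Ico l (n + 1), g t) - ((n - l + 1 : ℕ) : Γ))
               (degSum g l - (l : Γ)) •
        H.gen (n + 1) (fun i => if i = 0 then cyc n X l else cyc n X (l + i - 1))
                      (fun i => if i = 0 then C.idm (cyc n X l)
                                else a ((l + i - 1) % (n + 1)))

/-- The word `a₀ h₁^{j₀} d(a₁) h₂^{j₁} ⋯ hₙ^{j_{n−1}} d(aₙ) h₀^{jₙ}` appearing in the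
definition of the map `φ`. -/
def phiWord (C : CdgCategory k Γ) (n : ℕ) (X : ℕ → C.Obj) (a : ℕ → C.E) (v : ℕ → ℕ) :
    C.E :=
  match n with
  | 0 => a 0 * (C.curv (X 0)) ^ (v 0)
  | m + 1 =>
      a 0 * (C.curv (cyc (m + 1) X 1)) ^ (v 0) *
        chainProd
          (fun t => C.diff (a (t + 1)) * (C.curv (cyc (m + 1) X (t + 2))) ^ (v (t + 1))) m

/-- The statement that the `k[v]`-linear map `φ : H̄och^{II}(𝒞)[[v]] → (𝒞/[𝒞,𝒞])[[v]]`
is given on chains by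
`φ(a₀[a₁|⋯|aₙ]) = ∑_{j₀,…,jₙ ≥ 0} (a₀ h₁^{j₀} d(a₁) ⋯ d(aₙ) h₀^{jₙ} / (J+n)!) v^{J+n}`.
Here `phi n : W n →ₗ Q[[v]]` is the component of `φ` on weight-`n` chains, a power
series in `v` being modelled as the function recording its coefficients. -/
def IsPhi {Q : Type} [AddCommGroup Q] [Module k Q]
    (H : RedHochCore k Γ C) (q : C.E →ₗ[k] Q)
    (phi : (n : ℕ) → H.W n →ₗ[k] (ℕ → Q)) : Prop :=
  ∀ (n : ℕ) (X : ℕ → C.Obj) (a : ℕ → C.E) (g : ℕ → Γ),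
    C.Composable n X a → C.Homog n g a →
    phi n (H.gen n X a) = fun p =>
      if n ≤ p then
        ((p.factorial : k))⁻¹ •
          ∑ v ∈ Finset.Nat.antidiagonalTuple (n + 1) (p - n),
            q (phiWord C n X a (extTuple v))
      else 0

theorem gsign_add (x y : Γ) : gsign k (x + y) = gsign k x * gsign k y := by
  unfold gsign
  rw [map_add]
  generalize GradingGroup.parity x = s
  generalize GradingGroup.parity y = t
  have h : ∀ s t : ZMod 2, (s + t).val = (s.val + t.val) % 2 := by decide
  rw [h, ← neg_one_pow_eq_pow_mod_two, pow_add]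

theorem gsign_one : gsign k (1 : Γ) = -1 := by
  simp [gsign, GradingGroup.parity_one, ZMod.val_one]

theorem gsign_two : gsign k (2 : Γ) = 1 := by
  rw [← one_add_one_eq_two, gsign_add, gsign_one]
  norm_num

theorem gsign_mul_self (x : Γ) : gsign k x * gsign k x = 1 := by
  unfold gsign
  rw [← mul_pow]
  simp

theorem gsign_add_one (x : Γ) : gsign k (x + 1) = gsign k (x - 1) := by
  have h : x + 1 = x - 1 + 2 := by rw [← one_add_one_eq_two]; abel
  rw [h, gsign_add, gsign_two, mul_one]

theorem gsign_degSum_succ (g : ℕ → Γ) (j : ℕ) :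
    gsign k (degSum g (j + 2) - ((j + 1 : ℕ) : Γ)) =
      gsign k (g (j + 1) + 1) * gsign k (degSum g (j + 1) - (j : Γ)) := by
  rw [gsign_add_one, ← gsign_add]
  congr 1
  rw [degSum, sum_range_succ, ← degSum]
  push_cast
  abel

/-- Add up the `j`-th and `(j+1)`-st exponents. -/
def mergeExp (v : ℕ → ℕ) (j : ℕ) : ℕ → ℕ :=
  fun i => if i < j then v i else if i = j then v j + v (j + 1) else v (i + 1)

/-- Add the entry at `j` to its successor and remove it. -/
def mergeTuple {n : ℕ} (j : Fin (n + 1)) (v : Fin (n + 2) → ℕ) : Fin (n + 1) → ℕ :=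
  j.castSucc.removeNth v + Pi.single j (v j.castSucc)

theorem extTuple_mergeTuple {n : ℕ} (j : Fin (n + 1)) (v : Fin (n + 2) → ℕ) {t : ℕ}
    (ht : t ≤ n) : extTuple (mergeTuple j v) t = mergeExp (extTuple v) j t := by
  obtain ⟨j, hj⟩ := j
  have ht' : t < n + 1 := by omega
  rcases lt_trichotomy t j with h | rfl | h
  · have h₁ : t < n + 2 := by omega
    simp [extTuple, mergeTuple, mergeExp, ht', h₁, h, h.ne, Fin.removeNth, Fin.succAbove]
  · have h₁ : t < n + 2 := by omega
    simp [extTuple, mergeTuple, mergeExp, ht', h₁, Fin.removeNth, Fin.succAbove,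
      add_comm (v ⟨t, h₁⟩)]
    omega
  · have h₁ : ¬ t < j := by omega
    simp [extTuple, mergeTuple, mergeExp, ht', h₁, h.ne', Fin.removeNth, Fin.succAbove]
    omega

theorem sum_mergeTuple {n : ℕ} (j : Fin (n + 1)) (v : Fin (n + 2) → ℕ) :
    ∑ i, mergeTuple j v i = ∑ i, v i := by
  rw [Fin.sum_univ_succAbove v j.castSucc]
  simp [mergeTuple, sum_add_distrib, Fin.removeNth, add_comm]

theorem sum_antidiagonalTuple_mergeTuple {M : Type*} [AddCommMonoid M] {n : ℕ} (N : ℕ)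
    (j : Fin (n + 1)) (F : (Fin (n + 1) → ℕ) → M) :
    ∑ v ∈ Finset.Nat.antidiagonalTuple (n + 2) N, F (mergeTuple j v) =
      ∑ w ∈ Finset.Nat.antidiagonalTuple (n + 1) N, (w j + 1) • F w := by
  have h (w : Fin (n + 1) → ℕ) : (w j + 1) • F w = ∑ _s ∈ range (w j + 1), F w := by simp
  simp only [h]
  rw [sum_sigma']
  have hmerge (w : Fin (n + 1) → ℕ) (s : ℕ) (hs : s ≤ w j) :
      mergeTuple j (Fin.insertNth (α := fun _ => ℕ) j.castSucc s (w - Pi.single j s)) = w := by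
    rw [mergeTuple, Fin.removeNth_insertNth, Fin.insertNth_apply_same]
    funext i
    by_cases hi : i = j
    · subst hi; simp [hs]
    · simp [hi]
  refine sum_bij' (fun v _ => ⟨mergeTuple j v, v j.castSucc⟩)
    (fun p _ => Fin.insertNth (α := fun _ => ℕ) j.castSucc p.2 (p.1 - Pi.single j p.2))
    ?_ ?_ ?_ ?_ ?_
  · intro v hv
    simp only [mem_sigma, mem_range, Finset.Nat.mem_antidiagonalTuple] at hv ⊢
    refine ⟨by rw [sum_mergeTuple, hv], ?_⟩
    simp only [mergeTuple, Pi.add_apply, Pi.single_eq_same]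
    omega
  · rintro ⟨w, s⟩ hp
    simp only [mem_sigma, mem_range, Finset.Nat.mem_antidiagonalTuple] at hp ⊢
    rw [← sum_mergeTuple j, hmerge w s (by omega), hp.1]
  · intro v _
    simp [mergeTuple]
  · rintro ⟨w, s⟩ hp
    simp only [mem_sigma, mem_range] at hp
    simp [hmerge w s (by omega)]
  · intro v _
    rfl

theorem sum_sum_antidiagonalTuple_mergeTuple {M : Type*} [AddCommMonoid M] (n N : ℕ)
    (F : (Fin (n + 1) → ℕ) → M) :
    ∑ j, ∑ v ∈ Finset.Nat.antidiagonalTuple (n + 2) N, F (mergeTuple j v) =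
      (N + n + 1) • ∑ w ∈ Finset.Nat.antidiagonalTuple (n + 1) N, F w := by
  simp only [sum_antidiagonalTuple_mergeTuple]
  rw [sum_comm, smul_sum]
  refine sum_congr rfl fun w hw => ?_
  rw [Finset.Nat.mem_antidiagonalTuple] at hw
  rw [← sum_smul, sum_add_distrib, hw]
  simp [add_assoc]

theorem cyc_dupIdx {α : Type} (X : ℕ → α) {n j i : ℕ} (hj : j ≤ n) (hi : i ≤ n + 2) :
    cyc (n + 1) (dupIdx (cyc n X) j) i = dupIdx (cyc n X) j i := by
  rcases hi.lt_or_eq with hi | rfl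
  · rw [cyc, Nat.mod_eq_of_lt hi]
  · have h : ¬ n + 2 ≤ j + 1 := by omega
    simp [cyc, dupIdx, h]

theorem cyc_of_le {α : Type} (X : ℕ → α) {n i : ℕ} (hi : i ≤ n) : cyc n X i = X i := by
  rw [cyc, Nat.mod_eq_of_lt (by omega)]

namespace CdgCategory

/-- The word `a₀ h_{o 1}^{v 0} d(a₁) h_{o 2}^{v 1} ⋯ d(aₙ) h_{o (n+1)}^{v n}`. -/
def curvWord (C : CdgCategory k Γ) (o : ℕ → C.Obj) (a : ℕ → C.E) (v : ℕ → ℕ) : ℕ → C.E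
  | 0 => a 0 * C.curv (o 1) ^ v 0
  | n + 1 => curvWord C o a v n * (C.diff (a (n + 1)) * C.curv (o (n + 2)) ^ v (n + 1))

theorem phiWord_eq_curvWord (n : ℕ) (X : ℕ → C.Obj) (a : ℕ → C.E) (v : ℕ → ℕ) :
    phiWord C n X a v = C.curvWord (cyc n X) a v n := by
  cases n with
  | zero => simp [phiWord, curvWord, cyc]
  | succ m =>
    simp only [phiWord]
    generalize cyc (m + 1) X = o
    induction m with
    | zero => simp [chainProd, curvWord]
    | succ m ih => rw [chainProd, ← mul_assoc, ih, curvWord.eq_2 _ _ _ _ (m + 1)]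

theorem curvWord_congr {o o' : ℕ → C.Obj} {a a' : ℕ → C.E} {v v' : ℕ → ℕ} {n : ℕ}
    (ho : ∀ i ≤ n, o (i + 1) = o' (i + 1)) (ha : ∀ i ≤ n, a i = a' i)
    (hv : ∀ i ≤ n, v i = v' i) : C.curvWord o a v n = C.curvWord o' a' v' n := by
  induction n with
  | zero => simp [curvWord, ho 0 le_rfl, ha 0 le_rfl, hv 0 le_rfl]
  | succ n ih =>
    rw [curvWord, curvWord, ih (fun i hi => ho i (by omega)) (fun i hi => ha i (by omega))
      (fun i hi => hv i (by omega)), ho (n + 1) le_rfl, ha (n + 1) le_rfl, hv (n + 1) le_rfl]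

theorem mul_curv_pow_mem {X Y : C.Obj} {f : C.E} (hf : f ∈ C.Hom X Y) (s : ℕ) :
    f * C.curv X ^ s ∈ C.Hom X Y := by
  induction s with
  | zero => simpa using hf
  | succ s ih =>
    rw [pow_succ, ← mul_assoc]
    exact C.mul_hom_mem ih (C.curv_mem X)

theorem curvWord_mem {o : ℕ → C.Obj} {a : ℕ → C.E} {n : ℕ}
    (ha : ∀ i ≤ n, a i ∈ C.Hom (o (i + 1)) (o i)) (v : ℕ → ℕ) :
    C.curvWord o a v n ∈ C.Hom (o (n + 1)) (o 0) := by
  induction n with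
  | zero => exact mul_curv_pow_mem (ha 0 le_rfl) _
  | succ n ih =>
    exact C.mul_hom_mem (ih fun i hi => ha i (by omega))
      (mul_curv_pow_mem (C.diff_hom (ha (n + 1) le_rfl)) _)

theorem curvWord_mul_curv_pow (o : ℕ → C.Obj) (a : ℕ → C.E) (v : ℕ → ℕ) (j : ℕ) :
    C.curvWord o a v j * C.curv (o (j + 1)) ^ v (j + 1) =
      C.curvWord o a (mergeExp v j) j := by
  cases j with
  | zero => simp [curvWord, mergeExp, mul_assoc, pow_add]
  | succ j =>
    rw [curvWord, curvWord, curvWord_congr (v := mergeExp v (j + 1)) (v' := v)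
      (fun _ _ => rfl) (fun _ _ => rfl) (fun i hi => by simp [mergeExp]; omega)]
    simp [mergeExp, mul_assoc, pow_add]

theorem curv_pow_mul_diff {zel : C.Obj → C.E}
    (dz_central : ∀ {X Y : C.Obj} {γ : Γ} {α : C.E}, α ∈ C.Hom X Y → α ∈ C.deg γ →
      α * C.diff (zel X) = gsign k γ • (C.diff (zel Y) * α))
    (X : C.Obj) (s : ℕ) :
    C.curv X ^ s * C.diff (zel X) = C.diff (zel X) * C.curv X ^ s := by
  have h : Commute (C.curv X) (C.diff (zel X)) := by
    rw [Commute, SemiconjBy, dz_central (C.curv_mem X) (C.curv_deg X), gsign_two, one_smul]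
  exact h.pow_left s

theorem curvWord_mul_diff {zel : C.Obj → C.E}
    (dz_central : ∀ {X Y : C.Obj} {γ : Γ} {α : C.E}, α ∈ C.Hom X Y → α ∈ C.deg γ →
      α * C.diff (zel X) = gsign k γ • (C.diff (zel Y) * α))
    {o : ℕ → C.Obj} {a : ℕ → C.E} {g : ℕ → Γ} {n : ℕ}
    (ha : ∀ i ≤ n, a i ∈ C.Hom (o (i + 1)) (o i)) (hg : C.Homog n g a) (v : ℕ → ℕ) :
    C.curvWord o a v n * C.diff (zel (o (n + 1))) =
      gsign k (degSum g (n + 1) - (n : Γ)) •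
        (C.diff (zel (o 0)) * C.curvWord o a v n) := by
  induction n with
  | zero =>
    rw [curvWord, mul_assoc, curv_pow_mul_diff dz_central, ← mul_assoc,
      dz_central (ha 0 le_rfl) (hg 0 le_rfl)]
    simp [degSum, mul_assoc]
  | succ n ih =>
    have ih := ih (fun i hi => ha i (by omega)) (fun i hi => hg i (by omega))
    rw [curvWord, mul_assoc, mul_assoc, curv_pow_mul_diff dz_central,
      ← mul_assoc (C.diff (a (n + 1))),
      dz_central (C.diff_hom (ha (n + 1) le_rfl)) (C.diff_deg (hg (n + 1) le_rfl)),
      gsign_degSum_succ, mul_smul, smul_mul_assoc, mul_smul_comm, mul_assoc, ← mul_assoc,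
      ih, smul_mul_assoc, mul_assoc]

theorem curvWord_insertChain {zel : C.Obj → C.E}
    (dz_central : ∀ {X Y : C.Obj} {γ : Γ} {α : C.E}, α ∈ C.Hom X Y → α ∈ C.deg γ →
      α * C.diff (zel X) = gsign k γ • (C.diff (zel Y) * α))
    {o : ℕ → C.Obj} {a : ℕ → C.E} {g : ℕ → Γ} {j n : ℕ}
    (hj : j ≤ n) (ha : ∀ i ≤ n, a i ∈ C.Hom (o (i + 1)) (o i)) (hg : C.Homog n g a)
    (v : ℕ → ℕ) :
    C.curvWord (dupIdx o j) (insertChain a j (zel (o (j + 1)))) v (n + 1) =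
      gsign k (degSum g (j + 1) - (j : Γ)) •
        (C.diff (zel (o 0)) * C.curvWord o a (mergeExp v j) n) := by
  induction n, hj using Nat.le_induction with
  | base =>
    rw [curvWord, curvWord_congr (o' := o) (a' := a) (v' := v)
      (fun i hi => by simp [dupIdx, hi]) (fun i hi => by simp [insertChain, hi])
      (fun _ _ => rfl)]
    have h₁ : insertChain a j (zel (o (j + 1))) (j + 1) = zel (o (j + 1)) := by
      simp [insertChain]
    have h₂ : dupIdx o j (j + 2) = o (j + 1) := by simp [dupIdx]
    rw [h₁, h₂, ← mul_assoc, curvWord_mul_diff dz_central ha hg, smul_mul_assoc, mul_assoc,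
      curvWord_mul_curv_pow]
  | succ n hjn ih =>
    have h₁ : insertChain a j (zel (o (j + 1))) (n + 2) = a (n + 1) := by
      rw [insertChain, if_neg (by omega), if_neg (by omega)]; rfl
    have h₂ : dupIdx o j (n + 3) = o (n + 2) := by
      rw [dupIdx, if_neg (by omega)]; rfl
    have h₃ : mergeExp v j (n + 1) = v (n + 2) := by
      rw [mergeExp, if_neg (by omega), if_neg (by omega)]
    rw [curvWord, ih (fun i hi => ha i (by omega)) (fun i hi => hg i (by omega)), h₁, h₂,
      curvWord.eq_2 _ _ _ _ n, h₃, smul_mul_assoc, mul_assoc]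

theorem Composable.mem_hom_cyc {n : ℕ} {X : ℕ → C.Obj} {a : ℕ → C.E}
    (h : C.Composable n X a) (i : ℕ) (hi : i ≤ n) :
    a i ∈ C.Hom (cyc n X (i + 1)) (cyc n X i) := by
  rw [cyc_of_le X hi]
  exact h i hi

theorem Composable.insertChain {n j : ℕ} {X : ℕ → C.Obj} {a : ℕ → C.E}
    (h : C.Composable n X a) (hj : j ≤ n) {z : C.E}
    (hz : z ∈ C.Hom (cyc n X (j + 1)) (cyc n X (j + 1))) :
    C.Composable (n + 1) (dupIdx (cyc n X) j) (insertChain a j z) := by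
  intro i hi
  rw [cyc_dupIdx X hj (by omega)]
  rcases lt_trichotomy i (j + 1) with hij | rfl | hij
  · have h₁ : i ≤ j := by omega
    have h₂ : i ≤ j + 1 := by omega
    simpa [dupIdx, _root_.insertChain, h₁, h₂] using h.mem_hom_cyc i (by omega)
  · simpa [dupIdx, _root_.insertChain] using hz
  · obtain ⟨i, rfl⟩ : ∃ t, i = t + 1 := ⟨i - 1, by omega⟩
    have h₁ : ¬ i + 1 ≤ j := by omega
    have h₂ : ¬ i ≤ j := by omega
    have h₃ : i ≠ j := by omega
    simpa [dupIdx, _root_.insertChain, h₁, h₂, h₃] using h.mem_hom_cyc i (by omega)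

theorem Homog.insertChain {n j : ℕ} {g : ℕ → Γ} {a : ℕ → C.E} (h : C.Homog n g a)
    (hj : j ≤ n) {z : C.E} {γ : Γ} (hz : z ∈ C.deg γ) :
    C.Homog (n + 1) (insertChain g j γ) (insertChain a j z) := by
  intro i hi
  unfold _root_.insertChain
  split_ifs with h₁ h₂
  · exact h i (by omega)
  · exact hz
  · exact h (i - 1) (by omega)

end CdgCategory

/-- Let `k` be a field of characteristic `0`, `𝒞` a curved
differential `Γ`-graded category over `k`, and `z` a central element of degree `2` of
`𝒞` (a family `z_X ∈ End(X)²` with `α z_X = z_Y α` and `α d(z_X) = (−1)^{|α|} d(z_Y) α`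
for every `α : X → Y`).  Then `φ ∘ b₀^z = v·λ_{d(z)} ∘ φ` as maps
`H̄och^{II}(𝒞)[[v]] → (𝒞/[𝒞,𝒞])[[v]]`, where
`b₀^z(a₀[a₁|⋯|aₙ]) = ∑_j (−1)^{|a₀|+⋯+|a_j|−j} a₀[a₁|⋯|a_j|z_{X_{j+1}}|a_{j+1}|⋯|aₙ]`
and `λ_{d(z)}` is the endomorphism of `𝒞/[𝒞,𝒞]` induced by left multiplication by the
`d(z_X)`. -/
theorem phi_b0z_eq_lambda_dz
    (k Γ : Type) [Field k] [CharZero k] [GradingGroup Γ]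
    (C : CdgCategory k Γ) (H : RedHochCore k Γ C)
    -- the central element `z` of degree 2 :
    (zel : C.Obj → C.E)
    (z_mem : ∀ X, zel X ∈ C.Hom X X)
    (z_deg : ∀ X, zel X ∈ C.deg (2 : Γ))
    (z_central : ∀ {X Y : C.Obj} {α : C.E}, α ∈ C.Hom X Y → α * zel X = zel Y * α)
    (dz_central : ∀ {X Y : C.Obj} {γ : Γ} {α : C.E}, α ∈ C.Hom X Y → α ∈ C.deg γ →
      α * C.diff (zel X) = gsign k γ • (C.diff (zel Y) * α))
    -- the operator `b₀^z` :
    (b0z : (n : ℕ) → H.W n →ₗ[k] H.W (n + 1))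
    (hb0z : ∀ (n : ℕ) (X : ℕ → C.Obj) (a : ℕ → C.E) (g : ℕ → Γ),
      C.Composable n X a → C.Homog n g a →
      b0z n (H.gen n X a) = ∑ j ∈ Finset.range (n + 1),
        gsign k (degSum g (j + 1) - (j : Γ)) •
          H.gen (n + 1) (dupIdx (cyc n X) j) (insertChain a j (zel (cyc n X (j + 1)))))
    -- the quotient `Q = 𝒞/[𝒞,𝒞]` :
    (Q : Type) [AddCommGroup Q] [Module k Q] (q : C.E →ₗ[k] Q)
    (q_span : Submodule.span k
      {y : Q | ∃ (X : C.Obj) (x : C.E), x ∈ C.Hom X X ∧ y = q x} = ⊤)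
    (q_cyclic : ∀ {X Y : C.Obj} {γ γ' : Γ} {x y : C.E},
      x ∈ C.Hom Y X → y ∈ C.Hom X Y → x ∈ C.deg γ → y ∈ C.deg γ' →
      q (x * y) = gsign2 k γ γ' • q (y * x))
    -- left multiplication by `d(z)` on `𝒞/[𝒞,𝒞]` :
    (lamdz : Q →ₗ[k] Q)
    (lamdz_q : ∀ (X : C.Obj) (x : C.E), x ∈ C.Hom X X →
      lamdz (q x) = q (C.diff (zel X) * x))
    -- the map `φ` :
    (phi : (n : ℕ) → H.W n →ₗ[k] (ℕ → Q)) (hphi : IsPhi H q phi) :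
    ∀ (n : ℕ) (x : H.W n) (p : ℕ),
      phi (n + 1) (b0z n x) p = if p = 0 then 0 else lamdz (phi n x (p - 1)) := by
  intro n x p
  let L : H.W n →ₗ[k] Q := (LinearMap.proj p ∘ₗ phi (n + 1)) ∘ₗ b0z n
  let R : H.W n →ₗ[k] Q :=
    if p = 0 then 0 else lamdz ∘ₗ LinearMap.proj (p - 1) ∘ₗ phi n
  suffices hLR : L = R by
    have h := LinearMap.congr_fun hLR x
    simp only [L, R] at h
    split_ifs at h ⊢ <;> simpa using h
  refine LinearMap.ext_on (H.span_gen n) ?_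
  rintro _ ⟨X, a, g, hX, hg, rfl⟩
  have hX' := hX.mem_hom_cyc
  have hL : L (H.gen n X a) = ∑ j ∈ range (n + 1), if n + 1 ≤ p then
      ((p.factorial : k))⁻¹ • ∑ v ∈ Finset.Nat.antidiagonalTuple (n + 2) (p - (n + 1)),
        q (C.diff (zel (cyc n X 0)) * C.curvWord (cyc n X) a (mergeExp (extTuple v) j) n)
      else 0 := by
    simp only [L, LinearMap.comp_apply, LinearMap.proj_apply]
    rw [hb0z n X a g hX hg, map_sum, Finset.sum_apply]
    refine sum_congr rfl fun j hj => ?_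
    have hj : j ≤ n := by rw [mem_range] at hj; omega
    rw [map_smul, Pi.smul_apply, hphi (n + 1) _ _ _ (hX.insertChain hj (z_mem _))
      (hg.insertChain hj (z_deg _))]
    dsimp only
    split_ifs with hp
    · rw [smul_comm, smul_sum]
      congr 1
      refine sum_congr rfl fun v _ => ?_
      rw [CdgCategory.phiWord_eq_curvWord,
        CdgCategory.curvWord_congr (fun i hi => cyc_dupIdx X hj (by omega))
          (fun _ _ => rfl) (fun _ _ => rfl),
        CdgCategory.curvWord_insertChain dz_central hj hX' hg, map_smul, smul_smul,
        gsign_mul_self, one_smul]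
    · rw [smul_zero]
  rw [hL]
  rcases p with _ | p
  · simp [R]
  have hR : R (H.gen n X a) = lamdz (phi n (H.gen n X a) p) := by simp [R]
  rw [hR, hphi n X a g hX hg]
  simp only [Nat.add_le_add_iff_right, Nat.add_sub_add_right]
  split_ifs with hp
  · rw [← smul_sum, ← Fin.sum_univ_eq_sum_range (fun j : ℕ =>
      ∑ v ∈ Finset.Nat.antidiagonalTuple (n + 2) (p - n),
        q (C.diff (zel (cyc n X 0)) * C.curvWord (cyc n X) a (mergeExp (extTuple v) j) n))]
    have hmerge (j : Fin (n + 1)) (v : Fin (n + 2) → ℕ) :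
        C.curvWord (cyc n X) a (mergeExp (extTuple v) j) n =
          C.curvWord (cyc n X) a (extTuple (mergeTuple j v)) n :=
      CdgCategory.curvWord_congr (fun _ _ => rfl) (fun _ _ => rfl)
        fun i hi => (extTuple_mergeTuple j v hi).symm
    simp only [hmerge]
    rw [sum_sum_antidiagonalTuple_mergeTuple n (p - n) fun w =>
        q (C.diff (zel (cyc n X 0)) * C.curvWord (cyc n X) a (extTuple w) n),
      Nat.sub_add_cancel hp, map_smul, map_sum, ← Nat.cast_smul_eq_nsmul k, smul_smul,
      Nat.factorial_succ]
    congr 1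
    · have h₁ : ((p + 1 : ℕ) : k) ≠ 0 := Nat.cast_ne_zero.mpr p.succ_ne_zero
      push_cast at h₁ ⊢
      field_simp
    · refine sum_congr rfl fun w _ => ?_
      rw [CdgCategory.phiWord_eq_curvWord, lamdz_q (cyc n X 0)]
      simpa [cyc] using CdgCategory.curvWord_mem hX' (extTuple w)
  · simp

end
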